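/- Let 0<q<1 and let m and n be non-negative integers. Then ζ[m+2,{1}^n] = ζ[n+2,{1}^m]. -/

import Mathlib

/-- The `q`-analog of a natural number: `[k]_q = (1-q^k)/(1-q)`. -/
noncomputable def qnum (q : ℝ) (k : ℕ) : ℝ := (1 - q ^ k) / (1 - q)

/-- `ζ[m+2,{1}^n]`: the multiple q-zeta value with argument string `m+2`
followed by `n` ones, summed over `k₀ > k₁ > ⋯ > kₙ > 0`. -/
noncomputable def qzetaH (q : ℝ) (m n : ℕ) : ℝ :=
  ∑' k : {k : Fin (n + 1) → ℕ // (∀ i j : Fin (n + 1), i < j → k j < k i) ∧ ∀ j, 0 < k j},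
    (q ^ ((m + 1) * k.1 0) / (qnum q (k.1 0)) ^ (m + 2)) *
      ∏ j ∈ Finset.univ.erase (0 : Fin (n + 1)), 1 / qnum q (k.1 j)

open scoped ENNReal

section QNum

variable {q : ℝ}

lemma qnum_pos (hq0 : 0 < q) (hq1 : q < 1) {k : ℕ} (hk : 0 < k) : 0 < qnum q k :=
  div_pos (sub_pos.2 (pow_lt_one₀ hq0.le hq1 hk.ne')) (sub_pos.2 hq1)

@[simp] lemma qnum_zero : qnum q 0 = 0 := by simp [qnum]

lemma qnum_nonneg (hq0 : 0 < q) (hq1 : q < 1) (k : ℕ) : 0 ≤ qnum q k := by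
  rcases k.eq_zero_or_pos with rfl | hk
  · simp
  · exact (qnum_pos hq0 hq1 hk).le

lemma qnum_add (q : ℝ) (a b : ℕ) : qnum q (a + b) = qnum q a + q ^ a * qnum q b := by
  simp only [qnum, pow_add]
  ring

/-- The `q`-factorial `[n]_q!`. -/
noncomputable def qfact (q : ℝ) (n : ℕ) : ℝ := ∏ i ∈ Finset.range n, qnum q (i + 1)

lemma qfact_succ (q : ℝ) (n : ℕ) : qfact q (n + 1) = qfact q n * qnum q (n + 1) :=
  Finset.prod_range_succ _ _

lemma qfact_pos (hq0 : 0 < q) (hq1 : q < 1) (n : ℕ) : 0 < qfact q n :=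
  Finset.prod_pos fun _ _ => qnum_pos hq0 hq1 (Nat.succ_pos _)

/-- The Seki–Yamamoto connector `q^(ab) [a]_q! [b]_q! / [a+b]_q!`. -/
noncomputable def qconnector (q : ℝ) (a b : ℕ) : ℝ :=
  q ^ (a * b) * (qfact q a * qfact q b / qfact q (a + b))

lemma qconnector_comm (q : ℝ) (a b : ℕ) : qconnector q a b = qconnector q b a := by
  simp only [qconnector, mul_comm a b, add_comm a b, mul_comm (qfact q a)]

lemma qconnector_nonneg (hq0 : 0 < q) (hq1 : q < 1) (a b : ℕ) : 0 ≤ qconnector q a b := by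
  have := qfact_pos hq0 hq1
  exact mul_nonneg (by positivity)
    (div_nonneg (mul_nonneg (this a).le (this b).le) (this (a + b)).le)

lemma qconnector_zero_right (hq0 : 0 < q) (hq1 : q < 1) (a : ℕ) : qconnector q a 0 = 1 := by
  have h0 : qfact q 0 = 1 := Finset.prod_range_zero _
  simp [qconnector, h0, (qfact_pos hq0 hq1 a).ne']

lemma qconnector_succ_mul (hq0 : 0 < q) (hq1 : q < 1) (a b : ℕ) :
    qconnector q a (b + 1) * qnum q (a + (b + 1)) =
      q ^ a * qnum q (b + 1) * qconnector q a b := by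
  have h1 := (qfact_pos hq0 hq1 (a + b)).ne'
  have h2 := (qnum_pos hq0 hq1 (Nat.succ_pos (a + b))).ne'
  simp only [qconnector, ← add_assoc, qfact_succ, mul_add, pow_add, mul_one] at h2 ⊢
  field_simp

lemma qconnector_div (hq0 : 0 < q) (hq1 : q < 1) {a : ℕ} (ha : 0 < a) (b : ℕ) :
    qconnector q a (b + 1) * (1 / qnum q (b + 1)) =
      q ^ a / qnum q a * (qconnector q a b - qconnector q a (b + 1)) := by
  have h := qconnector_succ_mul hq0 hq1 a b
  rw [qnum_add] at h
  have h1 := (qnum_pos hq0 hq1 ha).ne'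
  have h2 := (qnum_pos hq0 hq1 (Nat.succ_pos b)).ne'
  field_simp
  linear_combination h

lemma qconnector_le_pow (hq0 : 0 < q) (hq1 : q < 1) (a b : ℕ) :
    qconnector q a b ≤ (q ^ a) ^ b := by
  induction b with
  | zero => simp [qconnector_zero_right hq0 hq1]
  | succ b ih =>
    have h := qconnector_succ_mul hq0 hq1 a b
    rw [add_comm a, qnum_add] at h
    have h1 := qnum_pos hq0 hq1 (Nat.succ_pos b)
    have h2 := mul_nonneg (qconnector_nonneg hq0 hq1 a (b + 1))
      (mul_nonneg (pow_pos hq0 (b + 1)).le (qnum_nonneg hq0 hq1 a))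
    have h3 : qconnector q a (b + 1) ≤ q ^ a * qconnector q a b := by
      refine le_of_mul_le_mul_right ?_ h1
      linarith
    calc _ ≤ _ := h3
      _ ≤ q ^ a * (q ^ a) ^ b := by gcongr
      _ = _ := by ring

lemma tendsto_qconnector (hq0 : 0 < q) (hq1 : q < 1) {a : ℕ} (ha : 0 < a) :
    Filter.Tendsto (qconnector q a) Filter.atTop (nhds 0) :=
  squeeze_zero (qconnector_nonneg hq0 hq1 a) (qconnector_le_pow hq0 hq1 a)
    (tendsto_pow_atTop_nhds_zero_of_lt_one (by positivity) (pow_lt_one₀ hq0.le hq1 ha.ne'))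

lemma hasSum_qconnector (hq0 : 0 < q) (hq1 : q < 1) {a : ℕ} (ha : 0 < a) (b : ℕ) :
    HasSum (fun c => if b < c then qconnector q a c * (1 / qnum q c) else 0)
      (q ^ a / qnum q a * qconnector q a b) := by
  have hinj : Function.Injective fun i : ℕ => b + i + 1 := fun i j h => by simpa using h
  rw [← hinj.hasSum_iff]
  · have hf : ((fun c => if b < c then qconnector q a c * (1 / qnum q c) else 0) ∘
        fun i => b + i + 1) = fun i => q ^ a / qnum q a *
          (qconnector q a (b + i) - qconnector q a (b + (i + 1))) := by
      ext i
      simp only [Function.comp, if_pos (show b < b + i + 1 by omega)]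
      exact qconnector_div hq0 hq1 ha (b + i)
    rw [hf]
    refine HasSum.mul_left _ ?_
    rw [hasSum_iff_tendsto_nat_of_nonneg]
    · simp_rw [Finset.sum_range_sub' fun i => qconnector q a (b + i)]
      have := (tendsto_qconnector hq0 hq1 ha).comp (Filter.tendsto_atTop_mono
        (fun n => Nat.le_add_left n b) Filter.tendsto_id)
      simpa [Function.comp_def] using this.const_sub (qconnector q a b)
    · intro i
      have h1 := qnum_pos hq0 hq1 ha
      have h2 := qconnector_div hq0 hq1 ha (b + i)
      refine nonneg_of_mul_nonneg_right (a := q ^ a / qnum q a) ?_ (by positivity)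
      rw [← add_assoc, ← h2]
      exact mul_nonneg (qconnector_nonneg hq0 hq1 _ _)
        (one_div_nonneg.2 (qnum_nonneg hq0 hq1 _))
  · intro c hc
    refine if_neg fun h => hc ⟨c - b - 1, ?_⟩
    dsimp only
    omega

end QNum

/-- The sum of `∏ w (k j)` over chains `k 0 > k 1 > ⋯ > k r` with `k 0 = a`. -/
noncomputable def chainSum (w : ℕ → ℝ≥0∞) : ℕ → ℕ → ℝ≥0∞
  | 0, a => w a
  | r + 1, a => w a * ∑' b, if b < a then chainSum w r b else 0

lemma chainSum_zero_right {w : ℕ → ℝ≥0∞} (hw : w 0 = 0) (r : ℕ) : chainSum w r 0 = 0 := by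
  cases r <;> simp [chainSum, hw]

open scoped Classical in
lemma tsum_chain (w : ℕ → ℝ≥0∞) (hw : w 0 = 0) (r : ℕ) (F : ℕ → ℝ≥0∞) :
    ∑' k : Fin (r + 1) → ℕ, (if (∀ i j : Fin (r + 1), i < j → k j < k i) ∧ ∀ j, 0 < k j
      then F (k 0) * ∏ j, w (k j) else 0) = ∑' a, F a * chainSum w r a := by
  induction r generalizing F with
  | zero =>
    rw [← (Equiv.funUnique (Fin 1) ℕ).symm.tsum_eq]
    refine tsum_congr fun a => ?_
    rcases a.eq_zero_or_pos with rfl | ha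
    · simp [chainSum, hw]
    · simp [chainSum, ha, Subsingleton.elim _ (0 : Fin 1)]
  | succ r ih =>
    rw [← (Fin.consEquiv fun _ : Fin (r + 2) => ℕ).tsum_eq, ENNReal.tsum_prod']
    refine tsum_congr fun a => ?_
    have h := ih fun b => if b < a then F a * w a else 0
    calc _ = _ := tsum_congr fun k => ?_
      _ = _ := h
      _ = _ := ?_
    · have hP : ((∀ i j : Fin (r + 2), i < j → (Fin.cons a k : Fin (r + 2) → ℕ) j <
            (Fin.cons a k : Fin (r + 2) → ℕ) i) ∧
            ∀ j, 0 < (Fin.cons a k : Fin (r + 2) → ℕ) j) ↔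
          k 0 < a ∧ (∀ i j : Fin (r + 1), i < j → k j < k i) ∧ ∀ j, 0 < k j := by
        constructor
        · rintro ⟨h1, h2⟩
          exact ⟨h1 0 (Fin.succ 0) (Fin.succ_pos 0),
            fun i j hij => h1 i.succ j.succ (Fin.succ_lt_succ_iff.2 hij), fun j => h2 j.succ⟩
        · rintro ⟨h0, h1, h2⟩
          have h3 : ∀ j, k j < a := fun j => by
            rcases eq_or_ne j 0 with rfl | hj
            · exact h0
            · exact (h1 0 j (Fin.pos_iff_ne_zero.2 hj)).trans h0
          refine ⟨fun i j => ?_, fun j => ?_⟩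
          · refine Fin.cases ?_ (fun i => ?_) i <;> refine Fin.cases ?_ (fun j => ?_) j
            · simp
            · simpa using h3 j
            · simp
            · simpa using h1 i j
          · refine Fin.cases ?_ (fun j => ?_) j
            · simpa using (Nat.zero_le _).trans_lt h0
            · simpa using h2 j
      simp only [Fin.consEquiv_apply, hP, Fin.prod_univ_succ (n := r + 1), Fin.cons_zero,
        Fin.cons_succ]
      by_cases hk : k 0 < a <;> simp [hk, mul_assoc]
    · rw [chainSum, ← mul_assoc, ← ENNReal.tsum_mul_left]
      exact tsum_congr fun b => by split_ifs <;> simp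

/-- The weights `1 / [k]_q` as extended nonnegative reals; the weight at `0` is `0`. -/
noncomputable def qweight (q : ℝ) (k : ℕ) : ℝ≥0∞ := ENNReal.ofReal (1 / qnum q k)

lemma qweight_zero (q : ℝ) : qweight q 0 = 0 := by simp [qweight]

section Transport

variable {q : ℝ}

lemma tsum_qconnector_mul_qweight (hq0 : 0 < q) (hq1 : q < 1) {a : ℕ} (ha : 0 < a) (b : ℕ) :
    ∑' c, (if b < c then ENNReal.ofReal (qconnector q a c) * qweight q c else 0) =
      ENNReal.ofReal (q ^ a / qnum q a) * ENNReal.ofReal (qconnector q a b) := by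
  have h := hasSum_qconnector hq0 hq1 ha b
  have h1 := qnum_nonneg hq0 hq1 a
  rw [← ENNReal.ofReal_mul (by positivity), ← h.tsum_eq,
    ENNReal.ofReal_tsum_of_nonneg _ h.summable]
  · refine tsum_congr fun c => ?_
    split_ifs
    · rw [qweight, ENNReal.ofReal_mul (qconnector_nonneg hq0 hq1 _ _)]
    · simp
  · intro c
    split_ifs
    · exact mul_nonneg (qconnector_nonneg hq0 hq1 _ _)
        (one_div_nonneg.2 (qnum_nonneg hq0 hq1 _))
    · exact le_rfl

lemma tsum_qconnector_mul_chainSum (hq0 : 0 < q) (hq1 : q < 1) {a : ℕ} (ha : 0 < a) (r : ℕ) :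
    ∑' c, ENNReal.ofReal (qconnector q a c) * chainSum (qweight q) r c =
      ENNReal.ofReal (q ^ a / qnum q a) ^ (r + 1) := by
  induction r with
  | zero =>
    have h := tsum_qconnector_mul_qweight hq0 hq1 ha 0
    rw [qconnector_zero_right hq0 hq1, ENNReal.ofReal_one, mul_one] at h
    rw [zero_add, pow_one, ← h]
    refine tsum_congr fun c => ?_
    rcases c.eq_zero_or_pos with rfl | hc
    · simp [chainSum, qweight_zero]
    · simp [chainSum, hc]
  | succ r ih =>
    rw [pow_succ', ← ih, ← ENNReal.tsum_mul_left]
    simp only [chainSum, ← mul_assoc, ← tsum_qconnector_mul_qweight hq0 hq1 ha,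
      ← ENNReal.tsum_mul_left, ← ENNReal.tsum_mul_right]
    rw [ENNReal.tsum_comm]
    refine tsum_congr fun b => tsum_congr fun c => ?_
    split_ifs <;> simp

lemma qzetaH_eq_toReal (hq0 : 0 < q) (hq1 : q < 1) (m n : ℕ) :
    qzetaH q m n = (∑' a, ENNReal.ofReal (q ^ a / qnum q a) ^ (m + 1) *
      chainSum (qweight q) n a).toReal := by
  classical
  have hn := qnum_nonneg hq0 hq1
  rw [← tsum_chain _ (qweight_zero q)]
  have h := tsum_subtype {k : Fin (n + 1) → ℕ |
    (∀ i j : Fin (n + 1), i < j → k j < k i) ∧ ∀ j, 0 < k j} fun k =>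
      ENNReal.ofReal (q ^ k 0 / qnum q (k 0)) ^ (m + 1) * ∏ j, qweight q (k j)
  simp only [Set.indicator_apply, Set.mem_ofPred_eq] at h
  rw [← h, ENNReal.tsum_toReal_eq]
  · refine tsum_congr fun k => ?_
    rw [← Finset.mul_prod_erase _ _ (Finset.mem_univ 0)]
    simp only [qweight, ENNReal.toReal_mul, ENNReal.toReal_pow, ENNReal.toReal_prod]
    rw [ENNReal.toReal_ofReal (div_nonneg (by positivity) (hn _)),
      ENNReal.toReal_ofReal (one_div_nonneg.2 (hn _)), ← mul_assoc]
    congr 1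
    · rw [div_pow, ← pow_mul, pow_succ (qnum q _) (m + 1), mul_comm (m + 1), div_mul_div_comm,
        mul_one]
    · exact Finset.prod_congr rfl fun j _ =>
        (ENNReal.toReal_ofReal (one_div_nonneg.2 (hn _))).symm
  · exact fun k => ENNReal.mul_ne_top (ENNReal.pow_ne_top ENNReal.ofReal_ne_top)
      (ENNReal.prod_ne_top fun _ _ => ENNReal.ofReal_ne_top)

lemma tsum_pow_mul_chainSum (hq0 : 0 < q) (hq1 : q < 1) (m n : ℕ) :
    ∑' a, ENNReal.ofReal (q ^ a / qnum q a) ^ (m + 1) * chainSum (qweight q) n a =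
      ∑' a, ∑' c, ENNReal.ofReal (qconnector q a c) *
        (chainSum (qweight q) m c * chainSum (qweight q) n a) := by
  refine tsum_congr fun a => ?_
  rcases a.eq_zero_or_pos with rfl | ha
  · simp [chainSum_zero_right (qweight_zero q)]
  · simp only [← tsum_qconnector_mul_chainSum hq0 hq1 ha m, ← ENNReal.tsum_mul_right, mul_assoc]

end Transport

/-- The duality `ζ[m+2,{1}^n] = ζ[n+2,{1}^m]`. -/
theorem qzetaH_symm (q : ℝ) (hq0 : 0 < q) (hq1 : q < 1) (m n : ℕ) :
    qzetaH q m n = qzetaH q n m := by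
  rw [qzetaH_eq_toReal hq0 hq1, qzetaH_eq_toReal hq0 hq1, tsum_pow_mul_chainSum hq0 hq1,
    tsum_pow_mul_chainSum hq0 hq1, ENNReal.tsum_comm]
  exact congrArg _ (tsum_congr fun a => tsum_congr fun c => by
    rw [qconnector_comm, mul_comm (chainSum _ _ _)])
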